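/- Let p, b, f : [0,1] → ℝ be infinitely differentiable with p(0) = 0, |p'(x)| ≥ |p'(0)|/2 > 0 for all x ∈ [0,1], and b(x) ≥ b₀ > 0, and fix boundary values u_L, u_R ∈ ℝ. Then: (i) for each ε > 0 there exists exactly one u ∈ C²([0,1]) satisfying -ε u''(x) + p(x) u'(x) + b(x) u(x) = f(x) on (0,1) with u(0) = u_L, u(1) = u_R; and (ii) there exists a constant C > 0, independent of ε, such that for every ε ∈ (0,1] this solution satisfies |p(x) u'(x)| ≤ C for all x ∈ [0, 1/2]. -/

import Mathlib

open Set

/-- `u` is a C² solution of the boundary turning point problem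
`-ε u'' + p u' + b u = f` on `(0,1)` with `u(0) = uL`, `u(1) = uR`. -/
def IsSolutionBTP (p b f : ℝ → ℝ) (uL uR ε : ℝ) (u : ℝ → ℝ) : Prop :=
  ContDiffOn ℝ 2 u (Icc (0 : ℝ) 1) ∧
  (∀ x ∈ Ioo (0 : ℝ) 1,
    -ε * deriv (deriv u) x + p x * deriv u x + b x * u x = f x) ∧
  u 0 = uL ∧ u 1 = uR

open scoped Topology

lemma abs_clamp_sub_clamp_le (R x y : ℝ) :
    |max (-R) (min R x) - max (-R) (min R y)| ≤ |x - y| :=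
  (abs_max_sub_max_le_max _ _ _ _).trans <| by
    have := abs_min_sub_min_le_max R x R y
    simpa using this

lemma abs_clamp_le_abs {R : ℝ} (hR : 0 ≤ R) (x : ℝ) : |max (-R) (min R x)| ≤ |x| := by
  have := abs_clamp_sub_clamp_le R x 0
  simpa [hR] using this

lemma abs_clamp_le {R : ℝ} (hR : 0 ≤ R) (x : ℝ) : |max (-R) (min R x)| ≤ R :=
  abs_le.2 ⟨le_max_left _ _, max_le (by linarith) (min_le_left _ _)⟩

lemma clamp_eq_self {R x : ℝ} (hx : |x| ≤ R) : max (-R) (min R x) = x := by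
  rw [abs_le] at hx
  rw [min_eq_right hx.2, max_eq_right hx.1]

lemma ContinuousOn.exists_abs_le_Icc {g : ℝ → ℝ} {a b : ℝ} (hg : ContinuousOn g (Icc a b)) :
    ∃ C > 0, ∀ x ∈ Icc a b, |g x| ≤ C := by
  obtain ⟨C, hC⟩ := isCompact_Icc.exists_bound_of_continuousOn hg
  exact ⟨max C 1, by positivity, fun x hx => (hC x hx).trans (le_max_left _ _)⟩

/-- Initial value problems for linear second order equations with continuous coefficients are
solvable on the whole interval. -/
lemma exists_linear_second_order_ivp {P B g : ℝ → ℝ} (hP : ContinuousOn P (Icc 0 1))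
    (hB : ContinuousOn B (Icc 0 1)) (hg : ContinuousOn g (Icc 0 1)) (u₀ v₀ : ℝ) :
    ∃ u v : ℝ → ℝ, u 0 = u₀ ∧ v 0 = v₀ ∧ ∀ t ∈ Icc (0 : ℝ) 1,
      HasDerivWithinAt u (v t) (Icc 0 1) t ∧
      HasDerivWithinAt v (P t * v t + B t * u t + g t) (Icc 0 1) t := by
  obtain ⟨K₁, hK₁, hPK⟩ := hP.exists_abs_le_Icc
  obtain ⟨K₂, hK₂, hBK⟩ := hB.exists_abs_le_Icc
  obtain ⟨K₃, hK₃, hgK⟩ := hg.exists_abs_le_Icc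
  set K : ℝ := K₁ + K₂ + 1 with hK
  set R : ℝ := gronwallBound ‖(u₀, v₀)‖ K K₃ 1 with hR
  have hmono := gronwallBound_mono (norm_nonneg (u₀, v₀)) hK₃.le (show 0 ≤ K by positivity)
  have hR₀ : 0 ≤ R :=
    ((norm_nonneg _).trans_eq (gronwallBound_x0 ‖(u₀, v₀)‖ K K₃).symm).trans (hmono zero_le_one)
  let c : ℝ → ℝ := fun x => max (-R) (min R x)
  let Φ : ℝ → ℝ × ℝ → ℝ × ℝ := fun t x => (c x.2, P t * c x.2 + B t * c x.1 + g t)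
  have hΦ_le : ∀ t ∈ Icc (0 : ℝ) 1, ∀ x : ℝ × ℝ, ∀ r, |c x.1| ≤ r → |c x.2| ≤ r →
      ‖Φ t x‖ ≤ K * r + K₃ := by
    intro t ht x r h1 h2
    have hr : 0 ≤ r := (abs_nonneg _).trans h1
    have e1 : |P t * c x.2| ≤ K₁ * r := by
      rw [abs_mul]; exact mul_le_mul (hPK t ht) h2 (abs_nonneg _) hK₁.le
    have e2 : |B t * c x.1| ≤ K₂ * r := by
      rw [abs_mul]; exact mul_le_mul (hBK t ht) h1 (abs_nonneg _) hK₂.le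
    refine max_le ?_ ?_
    · rw [Real.norm_eq_abs]
      have : 0 ≤ K₁ * r := by positivity
      have : 0 ≤ K₂ * r := by positivity
      simp only [Φ, hK]
      linarith
    · rw [Real.norm_eq_abs]
      have := hgK t ht
      refine (abs_add_le _ _).trans ((add_le_add_left (abs_add_le _ _) _).trans ?_)
      rw [hK]
      linarith
  have hPL : IsPicardLindelof Φ (tmin := 0) (tmax := 1) ⟨0, by simp⟩ (u₀, v₀)
      (K * R + K₃).toNNReal 0 (K * R + K₃).toNNReal K.toNNReal := by
    have hL : 0 ≤ K * R + K₃ := by positivity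
    refine ⟨fun t ht => LipschitzWith.lipschitzOnWith (LipschitzWith.of_dist_le_mul ?_), ?_, ?_, ?_⟩
    · intro x y
      rw [Real.coe_toNNReal _ (by positivity), dist_eq_norm, dist_eq_norm]
      have h1 : |c x.1 - c y.1| ≤ ‖x - y‖ :=
        (abs_clamp_sub_clamp_le _ _ _).trans (norm_fst_le (x - y))
      have h2 : |c x.2 - c y.2| ≤ ‖x - y‖ :=
        (abs_clamp_sub_clamp_le _ _ _).trans (norm_snd_le (x - y))
      have hr := norm_nonneg (x - y)
      have e1 : |P t * (c x.2 - c y.2)| ≤ K₁ * ‖x - y‖ := by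
        rw [abs_mul]; exact mul_le_mul (hPK t ht) h2 (abs_nonneg _) hK₁.le
      have e2 : |B t * (c x.1 - c y.1)| ≤ K₂ * ‖x - y‖ := by
        rw [abs_mul]; exact mul_le_mul (hBK t ht) h1 (abs_nonneg _) hK₂.le
      have e3 : 0 ≤ K₁ * ‖x - y‖ := by positivity
      have e4 : 0 ≤ K₂ * ‖x - y‖ := by positivity
      refine max_le ?_ ?_
      · simp only [Φ, hK, Real.norm_eq_abs, Prod.fst_sub]
        linarith
      · simp only [Φ, hK, Real.norm_eq_abs, Prod.snd_sub]
        rw [show P t * c x.2 + B t * c x.1 + g t - (P t * c y.2 + B t * c y.1 + g t)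
          = P t * (c x.2 - c y.2) + B t * (c x.1 - c y.1) by ring]
        refine (abs_add_le _ _).trans ?_
        linarith
    · intro x _
      exact continuousOn_const.prodMk
        (((hP.mul continuousOn_const).add (hB.mul continuousOn_const)).add hg)
    · intro t ht x _
      rw [Real.coe_toNNReal _ hL]
      exact hΦ_le t ht x R (abs_clamp_le hR₀ _) (abs_clamp_le hR₀ _)
    · simp
  obtain ⟨γ, hγ₀, hγ⟩ := hPL.exists_eq_forall_mem_Icc_hasDerivWithinAt₀
  simp only at hγ₀
  have hγR : ∀ t ∈ Icc (0 : ℝ) 1, ‖γ t‖ ≤ R := by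
    intro t ht
    refine (norm_le_gronwallBound_of_norm_deriv_right_le (f := γ) (f' := fun t => Φ t (γ t))
      (δ := ‖(u₀, v₀)‖) (K := K) (ε := K₃) (fun t ht => (hγ t ht).continuousWithinAt)
      (fun t ht => ?_) (by rw [hγ₀]) (fun t ht => ?_) t ht).trans ?_
    · exact (hγ t (Ico_subset_Icc_self ht)).mono_of_mem_nhdsWithin
        (Icc_mem_nhdsGE_of_mem ht)
    · exact hΦ_le t (Ico_subset_Icc_self ht) _ _
        ((abs_clamp_le_abs hR₀ _).trans (norm_fst_le (γ t)))
        ((abs_clamp_le_abs hR₀ _).trans (norm_snd_le (γ t)))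
    · exact hmono (by linarith [ht.2])
  refine ⟨fun t => (γ t).1, fun t => (γ t).2, by simp [hγ₀], by simp [hγ₀], fun t ht => ?_⟩
  have h1 : c (γ t).1 = (γ t).1 := clamp_eq_self ((norm_fst_le (γ t)).trans (hγR t ht))
  have h2 : c (γ t).2 = (γ t).2 := clamp_eq_self ((norm_snd_le (γ t)).trans (hγR t ht))
  have h := hγ t ht
  simp only [Φ, h1, h2] at h
  exact ⟨h.fst, h.snd⟩

lemma deriv_deriv_nonpos_of_isLocalMax {f : ℝ → ℝ} {x : ℝ} (hc : ContinuousAt f x)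
    (h : IsLocalMax f x) : deriv (deriv f) x ≤ 0 := by
  by_contra! hpos
  have hmin := isLocalMin_of_deriv_deriv_pos hpos h.deriv_eq_zero hc
  have heq : f =ᶠ[𝓝 x] fun _ => f x := by
    filter_upwards [h, hmin] with y h1 h2 using le_antisymm h1 h2
  have := heq.deriv.deriv_eq
  simp at this
  linarith

namespace IsSolutionBTP

variable {p b f f₁ f₂ : ℝ → ℝ} {uL uR uL₁ uR₁ uL₂ uR₂ ε : ℝ} {u u₁ u₂ : ℝ → ℝ}

lemma continuousOn (h : IsSolutionBTP p b f uL uR ε u) : ContinuousOn u (Icc 0 1) :=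
  h.1.continuousOn

lemma hasDerivAt (h : IsSolutionBTP p b f uL uR ε u) {x : ℝ} (hx : x ∈ Ioo (0 : ℝ) 1) :
    HasDerivAt u (deriv u x) x :=
  ((h.1.differentiableOn (by norm_num)).differentiableAt
    (Icc_mem_nhds hx.1 hx.2)).hasDerivAt

lemma hasDerivAt_deriv (h : IsSolutionBTP p b f uL uR ε u) {x : ℝ} (hx : x ∈ Ioo (0 : ℝ) 1) :
    HasDerivAt (deriv u) (deriv (deriv u) x) x := by
  have h2 : ContDiffOn ℝ (1 + 1) u (Ioo 0 1) :=
    (h.1.mono Ioo_subset_Icc_self).of_le (by norm_num [one_add_one_eq_two])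
  have h1 := ((contDiffOn_succ_iff_deriv_of_isOpen isOpen_Ioo).1 h2).2.2
  exact ((h1.differentiableOn (by norm_num)).differentiableAt
    (isOpen_Ioo.mem_nhds hx)).hasDerivAt

lemma zero : IsSolutionBTP p b 0 0 0 ε 0 :=
  ⟨contDiffOn_const, fun x _ => by simp [Pi.zero_def], rfl, rfl⟩

lemma sub (h₁ : IsSolutionBTP p b f₁ uL₁ uR₁ ε u₁) (h₂ : IsSolutionBTP p b f₂ uL₂ uR₂ ε u₂) :
    IsSolutionBTP p b (f₁ - f₂) (uL₁ - uL₂) (uR₁ - uR₂) ε (u₁ - u₂) := by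
  refine ⟨h₁.1.sub h₂.1, fun x hx => ?_, ?_, ?_⟩
  · have hd : deriv (u₁ - u₂) =ᶠ[𝓝 x] deriv u₁ - deriv u₂ := by
      filter_upwards [isOpen_Ioo.mem_nhds hx] with y hy
      exact ((h₁.hasDerivAt hy).sub (h₂.hasDerivAt hy)).deriv
    rw [hd.deriv_eq, hd.eq_of_nhds,
      ((h₁.hasDerivAt_deriv hx).sub (h₂.hasDerivAt_deriv hx)).deriv]
    simp only [Pi.sub_apply]
    linear_combination h₁.2.1 x hx - h₂.2.1 x hx
  · simp [h₁.2.2.1, h₂.2.2.1]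
  · simp [h₁.2.2.2, h₂.2.2.2]

lemma neg (h : IsSolutionBTP p b f uL uR ε u) : IsSolutionBTP p b (-f) (-uL) (-uR) ε (-u) := by
  simpa using zero.sub h

/-- The maximum principle: constant supersolutions bound the solution from above. -/
lemma le_of_le_mul (h : IsSolutionBTP p b f uL uR ε u) (hε : 0 < ε) {M : ℝ} (hL : uL ≤ M)
    (hR : uR ≤ M) (hb : ∀ x ∈ Ioo (0 : ℝ) 1, 0 < b x) (hf : ∀ x ∈ Ioo (0 : ℝ) 1, f x ≤ b x * M)
    {x : ℝ} (hx : x ∈ Icc (0 : ℝ) 1) : u x ≤ M := by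
  obtain ⟨z, hz, hmax⟩ := isCompact_Icc.exists_isMaxOn ⟨x, hx⟩ h.continuousOn
  refine (hmax hx).trans ?_
  by_contra! hzM
  have hz' : z ∈ Ioo (0 : ℝ) 1 := by
    refine ⟨hz.1.lt_of_ne ?_, hz.2.lt_of_ne ?_⟩
    · rintro rfl
      linarith [h.2.2.1]
    · rintro rfl
      linarith [h.2.2.2]
  have hloc : IsLocalMax u z := hmax.isLocalMax (Icc_mem_nhds hz'.1 hz'.2)
  have h2 := deriv_deriv_nonpos_of_isLocalMax (h.hasDerivAt hz').continuousAt hloc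
  have heq := h.2.1 z hz'
  rw [hloc.deriv_eq_zero] at heq
  nlinarith [mul_lt_mul_of_pos_left hzM (hb z hz'), hf z hz', mul_nonneg hε.le (neg_nonneg.2 h2)]

lemma abs_le (h : IsSolutionBTP p b f uL uR ε u) (hε : 0 < ε) {b₀ F : ℝ} (hb₀ : 0 < b₀)
    (hb : ∀ x ∈ Icc (0 : ℝ) 1, b₀ ≤ b x) (hF : 0 ≤ F) (hf : ∀ x ∈ Icc (0 : ℝ) 1, |f x| ≤ F) {x : ℝ}
    (hx : x ∈ Icc (0 : ℝ) 1) : |u x| ≤ |uL| + |uR| + F / b₀ := by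
  have hb' : ∀ x ∈ Ioo (0 : ℝ) 1, 0 < b x :=
    fun x hx => hb₀.trans_le (hb x (Ioo_subset_Icc_self hx))
  have hFb : 0 ≤ F / b₀ := by positivity
  have hf' : ∀ x ∈ Ioo (0 : ℝ) 1, |f x| ≤ b x * (|uL| + |uR| + F / b₀) := by
    intro x hx
    have hx' := Ioo_subset_Icc_self hx
    calc |f x| ≤ b₀ * (F / b₀) := (hf x hx').trans_eq (by field_simp)
      _ ≤ b x * (|uL| + |uR| + F / b₀) :=
        mul_le_mul (hb x hx') (le_add_of_nonneg_left (by positivity)) hFb (hb' x hx).le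
  have hL := abs_nonneg uL
  have hR := abs_nonneg uR
  refine abs_le'.2 ⟨h.le_of_le_mul hε (by linarith [le_abs_self uL])
    (by linarith [le_abs_self uR]) hb' (fun x hx => (le_abs_self _).trans (hf' x hx)) hx,
    h.neg.le_of_le_mul hε (by linarith [neg_le_abs uL])
    (by linarith [neg_le_abs uR]) hb' (fun x hx => (neg_le_abs _).trans (hf' x hx)) hx⟩

lemma eqOn (h₁ : IsSolutionBTP p b f uL uR ε u₁) (h₂ : IsSolutionBTP p b f uL uR ε u₂)
    (hε : 0 < ε) (hb : ∀ x ∈ Ioo (0 : ℝ) 1, 0 < b x) : EqOn u₁ u₂ (Icc 0 1) := by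
  intro x hx
  refine le_antisymm (sub_nonpos.1 ?_) (sub_nonpos.1 ?_)
  · exact (h₁.sub h₂).le_of_le_mul hε (by simp) (by simp) hb (by simp) hx
  · exact (h₂.sub h₁).le_of_le_mul hε (by simp) (by simp) hb (by simp) hx

lemma of_hasDerivWithinAt {v w : ℝ → ℝ}
    (hu : ∀ t ∈ Icc (0 : ℝ) 1, HasDerivWithinAt u (v t) (Icc 0 1) t)
    (hv : ∀ t ∈ Icc (0 : ℝ) 1, HasDerivWithinAt v (w t) (Icc 0 1) t)
    (hw : ContinuousOn w (Icc 0 1))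
    (heq : ∀ t ∈ Ioo (0 : ℝ) 1, -ε * w t + p t * v t + b t * u t = f t) :
    IsSolutionBTP p b f (u 0) (u 1) ε u := by
  have hU : UniqueDiffOn ℝ (Icc (0 : ℝ) 1) := uniqueDiffOn_Icc zero_lt_one
  have hd : ∀ t ∈ Ioo (0 : ℝ) 1, deriv u t = v t := fun t ht =>
    ((hu t (Ioo_subset_Icc_self ht)).hasDerivAt (Icc_mem_nhds ht.1 ht.2)).deriv
  have hv1 : ContDiffOn ℝ (0 + 1) v (Icc 0 1) := by
    rw [contDiffOn_succ_iff_derivWithin hU]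
    refine ⟨fun t ht => (hv t ht).differentiableWithinAt, by simp, ?_⟩
    exact contDiffOn_zero.2 (hw.congr fun t ht => (hv t ht).derivWithin (hU t ht))
  have hu2 : ContDiffOn ℝ (1 + 1) u (Icc 0 1) := by
    rw [contDiffOn_succ_iff_derivWithin hU]
    refine ⟨fun t ht => (hu t ht).differentiableWithinAt, by simp, ?_⟩
    rw [zero_add] at hv1
    exact hv1.congr fun t ht => (hu t ht).derivWithin (hU t ht)
  refine ⟨hu2.of_le (by norm_num [one_add_one_eq_two]), fun t ht => ?_, rfl, rfl⟩
  have hdd : deriv (deriv u) t = w t := by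
    have : deriv u =ᶠ[𝓝 t] v := by
      filter_upwards [isOpen_Ioo.mem_nhds ht] with s hs using hd s hs
    rw [this.deriv_eq]
    exact ((hv t (Ioo_subset_Icc_self ht)).hasDerivAt (Icc_mem_nhds ht.1 ht.2)).deriv
  rw [hdd, hd t ht, heq t ht]

end IsSolutionBTP

/-- Existence for the boundary value problem, by shooting. -/
lemma exists_isSolutionBTP {p b f : ℝ → ℝ} (hp : ContinuousOn p (Icc 0 1))
    (hb : ContinuousOn b (Icc 0 1)) (hf : ContinuousOn f (Icc 0 1))
    (hb_pos : ∀ x ∈ Ioo (0 : ℝ) 1, 0 < b x) (uL uR : ℝ) {ε : ℝ} (hε : 0 < ε) :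
    ∃ u, IsSolutionBTP p b f uL uR ε u := by
  have hP : ContinuousOn (fun t => p t / ε) (Icc 0 1) := hp.div_const _
  have hB : ContinuousOn (fun t => b t / ε) (Icc 0 1) := hb.div_const _
  have hG : ContinuousOn (fun t => -f t / ε) (Icc 0 1) := hf.neg.div_const _
  obtain ⟨u₁, v₁, hu₁, -, h₁⟩ := exists_linear_second_order_ivp hP hB hG uL 0
  obtain ⟨u₂, v₂, hu₂, hv₂, h₂⟩ :=
    exists_linear_second_order_ivp hP hB (continuousOn_const (c := (0 : ℝ))) 0 1
  have hcont : ∀ {u v : ℝ → ℝ}, (∀ t ∈ Icc (0 : ℝ) 1, HasDerivWithinAt u (v t) (Icc 0 1) t) →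
      ContinuousOn u (Icc 0 1) := fun h t ht => (h t ht).continuousWithinAt
  have hcu₁ := hcont fun t ht => (h₁ t ht).1
  have hcv₁ := hcont fun t ht => (h₁ t ht).2
  have hcu₂ := hcont fun t ht => (h₂ t ht).1
  have hcv₂ := hcont fun t ht => (h₂ t ht).2
  have hc₁ := ((hP.mul hcv₁).add (hB.mul hcu₁)).add hG
  have hc₂ := ((hP.mul hcv₂).add (hB.mul hcu₂)).add (continuousOn_const (c := (0 : ℝ)))
  have hsol₂ : IsSolutionBTP p b 0 (u₂ 0) (u₂ 1) ε u₂ :=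
    .of_hasDerivWithinAt (fun t ht => (h₂ t ht).1) (fun t ht => (h₂ t ht).2) hc₂
      fun t _ => by simp only [Pi.zero_apply]; field_simp; ring
  have hne : u₂ 1 ≠ 0 := by
    intro h0
    rw [hu₂, h0] at hsol₂
    have hzero := hsol₂.eqOn .zero hε hb_pos
    have hmem : (0 : ℝ) ∈ Icc (0 : ℝ) 1 := by simp
    have hd := (h₂ 0 hmem).1
    rw [hv₂] at hd
    have hd' : HasDerivWithinAt u₂ 0 (Icc 0 1) 0 :=
      (hasDerivWithinAt_const (0 : ℝ) _ (0 : ℝ)).congr hzero hu₂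
    exact one_ne_zero ((uniqueDiffOn_Icc zero_lt_one 0 hmem).eq_deriv _ hd hd')
  set k := (uR - u₁ 1) / u₂ 1 with hk
  have hsol : IsSolutionBTP p b f ((fun t => u₁ t + k * u₂ t) 0) ((fun t => u₁ t + k * u₂ t) 1) ε
      (fun t => u₁ t + k * u₂ t) :=
    .of_hasDerivWithinAt (fun t ht => (h₁ t ht).1.add ((h₂ t ht).1.const_mul k))
      (fun t ht => (h₁ t ht).2.add ((h₂ t ht).2.const_mul k))
      (hc₁.add (continuousOn_const.mul hc₂)) fun t _ => by field_simp; ring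
  refine ⟨fun t => u₁ t + k * u₂ t, ?_⟩
  have h0 : u₁ 0 + k * u₂ 0 = uL := by simp [hu₁, hu₂]
  have h1 : u₁ 1 + k * u₂ 1 = uR := by rw [hk, div_mul_cancel₀ _ hne]; ring
  rwa [← h0, ← h1]

lemma le_of_hasDerivAt_neg_on_level {w w' : ℝ → ℝ} {a c K : ℝ} (hac : a ≤ c)
    (hw : ∀ t ∈ Icc a c, HasDerivAt w (w' t) t) (ha : w a ≤ K)
    (hK : ∀ t ∈ Icc a c, w t = K → w' t < 0) : w c ≤ K :=
  image_le_of_deriv_right_lt_deriv_boundary (B := fun _ => K) (B' := fun _ => 0)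
    (fun t ht => (hw t ht).continuousAt.continuousWithinAt)
    (fun t ht => (hw t (Ico_subset_Icc_self ht)).hasDerivWithinAt) ha
    (fun t => hasDerivAt_const t K) (fun t ht => hK t (Ico_subset_Icc_self ht))
    (right_mem_Icc.2 hac)

lemma le_of_hasDerivAt_pos_on_level {w w' : ℝ → ℝ} {a c K : ℝ} (hac : a ≤ c)
    (hw : ∀ t ∈ Icc a c, HasDerivAt w (w' t) t) (hc : w c ≤ K)
    (hK : ∀ t ∈ Icc a c, w t = K → 0 < w' t) : w a ≤ K := by
  have hmem : ∀ t ∈ Icc (-c) (-a), -t ∈ Icc a c := fun t ht =>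
    ⟨by linarith [ht.2], by linarith [ht.1]⟩
  have := le_of_hasDerivAt_neg_on_level (w := fun t => w (-t)) (w' := fun t => -w' (-t))
    (neg_le_neg hac) (fun t ht => by
      simpa [Function.comp_def] using (hw _ (hmem t ht)).scomp t (hasDerivAt_neg t)) (by simpa using hc)
    (fun t ht h => neg_neg_of_pos (hK _ (hmem t ht) h))
  simpa using this

namespace IsSolutionBTP

variable {p b f : ℝ → ℝ} {uL uR ε : ℝ} {u : ℝ → ℝ}

lemma exists_deriv_le (h : IsSolutionBTP p b f uL uR ε u) {M : ℝ}
    (hM : ∀ z ∈ Icc (0 : ℝ) 1, |u z| ≤ M) {y z : ℝ} (hy : 0 ≤ y) (hyz : y < z) (hz : z ≤ 1) :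
    ∃ t ∈ Ioo y z, deriv u t ≤ 2 * M / (z - y) := by
  have hsub : Icc y z ⊆ Icc (0 : ℝ) 1 := Icc_subset_Icc hy hz
  have hsub' : Ioo y z ⊆ Ioo (0 : ℝ) 1 := Ioo_subset_Ioo hy hz
  obtain ⟨t, ht, hslope⟩ := exists_deriv_eq_slope u hyz (h.continuousOn.mono hsub)
    fun t ht => (h.hasDerivAt (hsub' ht)).differentiableAt.differentiableWithinAt
  refine ⟨t, ht, ?_⟩
  rw [hslope]
  have h1 := (abs_le'.1 (hM z (hsub (right_mem_Icc.2 hyz.le)))).1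
  have h2 := (abs_le'.1 (hM y (hsub (left_mem_Icc.2 hyz.le)))).2
  exact div_le_div_of_nonneg_right (by linarith) (sub_nonneg.2 hyz.le)

lemma deriv_le (h : IsSolutionBTP p b f uL uR ε u) (hε : 0 < ε) {M G c : ℝ} (hM₀ : 0 ≤ M)
    (hG₀ : 0 ≤ G) (hc : 0 < c) (hM : ∀ z ∈ Icc (0 : ℝ) 1, |u z| ≤ M)
    (hG : ∀ z ∈ Icc (0 : ℝ) 1, |f z - b z * u z| ≤ G)
    (hp : (∀ z ∈ Icc (0 : ℝ) 1, p z ≤ -(c * z)) ∨ ∀ z ∈ Icc (0 : ℝ) 1, c * z ≤ p z)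
    {x : ℝ} (hx : x ∈ Ioc (0 : ℝ) (1 / 2)) : deriv u x ≤ (4 * M + 2 * G / c + 1) / x := by
  obtain ⟨hx0, hx1⟩ := hx
  set K := (4 * M + 2 * G / c + 1) / x with hK
  have hK₀ : 0 ≤ K := by positivity
  have hMK : 2 * M / (x / 2) ≤ K := by
    rw [hK, div_div_eq_mul_div]
    gcongr
    have : 0 ≤ 2 * G / c := by positivity
    linarith
  have hGK : ∀ z, x / 2 ≤ z → G < c * z * K := by
    intro z hz
    have hz₀ : 0 < z := by linarith
    calc G < c * (x / 2) * ((2 * G / c + 1) / x) := by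
          field_simp
          linarith
      _ ≤ c * z * K := by
          rw [hK]
          gcongr
          linarith
  have hode : ∀ z ∈ Ioo (0 : ℝ) 1, ε * deriv (deriv u) z = p z * deriv u z - (f z - b z * u z) :=
    fun z hz => by linear_combination -h.2.1 z hz
  rcases hp with hp | hp
  · obtain ⟨y, hy, hyM⟩ := h.exists_deriv_le hM (y := x / 2) (z := x) (by linarith) (by linarith)
      (by linarith)
    have hsub : Icc y x ⊆ Ioo (0 : ℝ) 1 := fun t ht =>
      ⟨by linarith [ht.1, hy.1], by linarith [ht.2]⟩
    refine le_of_hasDerivAt_neg_on_level hy.2.le (fun t ht => h.hasDerivAt_deriv (hsub ht))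
      (hyM.trans ?_) fun t ht htK => ?_
    · rwa [show x - x / 2 = x / 2 by ring]
    · have ht' := hsub ht
      have ht'' := Ioo_subset_Icc_self ht'
      have e1 := hode t ht'
      rw [htK] at e1
      have e2 := hGK t (by linarith [ht.1, hy.1])
      have e3 := mul_le_mul_of_nonneg_right (hp t ht'') hK₀
      have e4 := (_root_.abs_le.1 (hG t ht'')).1
      exact neg_of_mul_neg_right (by linarith : ε * deriv (deriv u) t < 0) hε.le
  · obtain ⟨y, hy, hyM⟩ := h.exists_deriv_le hM (y := x) (z := x + x / 2) hx0.le (by linarith)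
      (by linarith)
    have hsub : Icc x y ⊆ Ioo (0 : ℝ) 1 := fun t ht =>
      ⟨by linarith [ht.1], by linarith [ht.2, hy.2]⟩
    refine le_of_hasDerivAt_pos_on_level hy.1.le (fun t ht => h.hasDerivAt_deriv (hsub ht))
      (hyM.trans ?_) fun t ht htK => ?_
    · rwa [add_sub_cancel_left]
    · have ht' := hsub ht
      have ht'' := Ioo_subset_Icc_self ht'
      have e1 := hode t ht'
      rw [htK] at e1
      have e2 := hGK t (by linarith [ht.1])
      have e3 := mul_le_mul_of_nonneg_right (hp t ht'') hK₀
      have e4 := (_root_.abs_le.1 (hG t ht'')).2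
      exact pos_of_mul_pos_right (by linarith : 0 < ε * deriv (deriv u) t) hε.le

lemma abs_deriv_le (h : IsSolutionBTP p b f uL uR ε u) (hε : 0 < ε) {M G c : ℝ} (hM₀ : 0 ≤ M)
    (hG₀ : 0 ≤ G) (hc : 0 < c) (hM : ∀ z ∈ Icc (0 : ℝ) 1, |u z| ≤ M)
    (hG : ∀ z ∈ Icc (0 : ℝ) 1, |f z - b z * u z| ≤ G)
    (hp : (∀ z ∈ Icc (0 : ℝ) 1, p z ≤ -(c * z)) ∨ ∀ z ∈ Icc (0 : ℝ) 1, c * z ≤ p z)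
    {x : ℝ} (hx : x ∈ Ioc (0 : ℝ) (1 / 2)) : |deriv u x| ≤ (4 * M + 2 * G / c + 1) / x := by
  refine abs_le'.2 ⟨h.deriv_le hε hM₀ hG₀ hc hM hG hp hx, ?_⟩
  have := h.neg.deriv_le hε hM₀ hG₀ hc (by simpa using hM)
    (fun z hz => by
      rw [← abs_neg]
      refine le_of_eq_of_le (congrArg _ ?_) (hG z hz)
      simp only [Pi.neg_apply]
      ring) hp hx
  rwa [deriv.neg] at this

end IsSolutionBTP

/-- A function vanishing at `0` whose derivative is bounded away from zero on `[0, 1]` grows at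
least linearly in absolute value, with constant sign. -/
lemma linear_growth_of_le_abs_deriv {p : ℝ → ℝ} {c : ℝ} (hc : 0 < c) (hp₀ : p 0 = 0)
    (hp : ∀ x ∈ Icc (0 : ℝ) 1, c ≤ |deriv p x|) :
    (∀ z ∈ Icc (0 : ℝ) 1, p z ≤ -(c * z)) ∨ ∀ z ∈ Icc (0 : ℝ) 1, c * z ≤ p z := by
  have hne : ∀ x ∈ Icc (0 : ℝ) 1, deriv p x ≠ 0 := fun x hx =>
    abs_pos.1 (hc.trans_le (hp x hx))
  have hd : ∀ x ∈ Icc (0 : ℝ) 1, DifferentiableAt ℝ p x := fun x hx =>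
    differentiableAt_of_deriv_ne_zero (hne x hx)
  have hcont : ContinuousOn p (Icc 0 1) := fun x hx => (hd x hx).continuousAt.continuousWithinAt
  have hdiff : DifferentiableOn ℝ p (interior (Icc 0 1)) := fun x hx =>
    (hd x (interior_subset hx)).differentiableWithinAt
  have h0 : (0 : ℝ) ∈ Icc (0 : ℝ) 1 := by simp
  rcases hasDerivWithinAt_forall_lt_or_forall_gt_of_forall_ne (convex_Icc (0 : ℝ) 1)
    (fun x hx => (hd x hx).hasDerivAt.hasDerivWithinAt) hne with hneg | hpos
  · refine .inl fun z hz => ?_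
    have := (convex_Icc (0 : ℝ) 1).image_sub_le_mul_sub_of_deriv_le hcont hdiff (C := -c)
      (fun x hx => by
        have hx := interior_subset hx
        have := hp x hx
        rw [abs_of_neg (hneg x hx)] at this
        linarith) 0 h0 z hz hz.1
    simpa [hp₀] using this
  · refine .inr fun z hz => ?_
    have := (convex_Icc (0 : ℝ) 1).mul_sub_le_image_sub_of_le_deriv hcont hdiff (C := c)
      (fun x hx => by
        have hx := interior_subset hx
        simpa only [abs_of_pos (hpos x hx)] using hp x hx) 0 h0 z hz hz.1
    simpa [hp₀] using this

lemma exists_abs_le_mul_of_contDiffOn {p : ℝ → ℝ} (hp : ContDiffOn ℝ 1 p (Icc 0 1))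
    (hp₀ : p 0 = 0) : ∃ C > 0, ∀ x ∈ Icc (0 : ℝ) 1, |p x| ≤ C * x := by
  obtain ⟨C, hC, hbound⟩ :=
    (hp.continuousOn_derivWithin (uniqueDiffOn_Icc zero_lt_one) le_rfl).exists_abs_le_Icc
  refine ⟨C, hC, fun x hx => ?_⟩
  have := (convex_Icc (0 : ℝ) 1).norm_image_sub_le_of_norm_derivWithin_le
    (hp.differentiableOn (by norm_num)) hbound (left_mem_Icc.2 zero_le_one) hx
  simpa [hp₀, abs_of_nonneg hx.1] using this

/-- Lemma 2.1: existence, uniqueness, and the uniform bound `|p(x) u'(x)| ≤ C`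
on `[0, 1/2]` for the single boundary turning point problem. -/
theorem stmt2 (p b f : ℝ → ℝ) (b₀ : ℝ) (hb₀ : 0 < b₀)
    (hp : ContDiffOn ℝ (⊤ : ℕ∞) p (Icc (0 : ℝ) 1))
    (hb : ContDiffOn ℝ (⊤ : ℕ∞) b (Icc (0 : ℝ) 1))
    (hf : ContDiffOn ℝ (⊤ : ℕ∞) f (Icc (0 : ℝ) 1))
    (hp0 : p 0 = 0) (hp'0 : 0 < |deriv p 0|)
    (hp'lb : ∀ x ∈ Icc (0 : ℝ) 1, |deriv p 0| / 2 ≤ |deriv p x|)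
    (hblb : ∀ x ∈ Icc (0 : ℝ) 1, b₀ ≤ b x)
    (uL uR : ℝ) :
    (∀ ε > (0 : ℝ),
      (∃ u : ℝ → ℝ, IsSolutionBTP p b f uL uR ε u) ∧
      (∀ u v : ℝ → ℝ, IsSolutionBTP p b f uL uR ε u →
        IsSolutionBTP p b f uL uR ε v → EqOn u v (Icc (0 : ℝ) 1))) ∧
    (∃ C > 0, ∀ ε ∈ Ioc (0 : ℝ) 1, ∀ u : ℝ → ℝ, IsSolutionBTP p b f uL uR ε u →
      ∀ x ∈ Icc (0 : ℝ) (1 / 2), |p x * deriv u x| ≤ C) := by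
  have hb_pos : ∀ x ∈ Ioo (0 : ℝ) 1, 0 < b x := fun x hx =>
    hb₀.trans_le (hblb x (Ioo_subset_Icc_self hx))
  refine ⟨fun ε hε => ⟨exists_isSolutionBTP hp.continuousOn hb.continuousOn hf.continuousOn
    hb_pos uL uR hε, fun u v hu hv => hu.eqOn hv hε hb_pos⟩, ?_⟩
  obtain ⟨F, hF, hfF⟩ := hf.continuousOn.exists_abs_le_Icc
  obtain ⟨β, hβ, hbβ⟩ := hb.continuousOn.exists_abs_le_Icc
  obtain ⟨P, hP, hpP⟩ := exists_abs_le_mul_of_contDiffOn (hp.of_le (by exact_mod_cast le_top)) hp0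
  set c := |deriv p 0| / 2 with hc_def
  have hc : 0 < c := by positivity
  have hgrowth := linear_growth_of_le_abs_deriv hc hp0 hp'lb
  set M := |uL| + |uR| + F / b₀ with hM_def
  have hM : 0 ≤ M := by positivity
  set G := F + β * M with hG_def
  have hG : 0 ≤ G := by positivity
  refine ⟨P * (4 * M + 2 * G / c + 1), by positivity, fun ε hε u hu x hx => ?_⟩
  rcases hx.1.eq_or_lt with rfl | hx0
  · rw [hp0, zero_mul, abs_zero]
    positivity
  have huM : ∀ z ∈ Icc (0 : ℝ) 1, |u z| ≤ M := fun z hz => hu.abs_le hε.1 hb₀ hblb hF.le hfF hz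
  have huG : ∀ z ∈ Icc (0 : ℝ) 1, |f z - b z * u z| ≤ G := fun z hz =>
    (abs_sub _ _).trans <| add_le_add (hfF z hz) <| by
      rw [abs_mul]
      exact mul_le_mul (hbβ z hz) (huM z hz) (abs_nonneg _) hβ.le
  have hd := hu.abs_deriv_le hε.1 hM hG hc huM huG hgrowth ⟨hx0, hx.2⟩
  rw [abs_mul]
  calc |p x| * |deriv u x| ≤ P * x * ((4 * M + 2 * G / c + 1) / x) :=
        mul_le_mul (hpP x ⟨hx.1, by linarith [hx.2]⟩) hd (abs_nonneg _) (by positivity)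
    _ = P * (4 * M + 2 * G / c + 1) := by field_simp
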